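/- Sure success of the interval MK test (part b): Let f : ℝⁿ → ℝⁿ be twice continuously differentiable, α a zero of f, and B a box of width w > 0 containing α. Let λ ≥ w, let Δ be the closed Euclidean ball of radius 2√n·λ centered at α, and assume J(x) is invertible for all x ∈ Δ and 27·n·λ·sup{ ‖ |J(x)⁻¹| · K(Δ) ‖ : x ∈ Δ } ≤ 1 (|J(x)⁻¹| is the entrywise absolute value). Let m ∈ B and g := J(m)⁻¹·f. Let L > 0 and assume w ≤ 1/(64·n²·L·sup{‖J(x)⁻¹‖ : x ∈ Δ}). For each face F = (2B)_i^s (i ∈ {1,…,n}, s ∈ {+,−}) and each pair j, k ∈ {1,…,n}, let G_{jk}(F) be a nonempty compact interval with {∂f_j/∂x_k(x) : x ∈ F} ⊆ G_{jk}(F) and w(G_{jk}(F)) ≤ 2·L·w. Define I_{ij}(F) := Σ_{k=1}^n [J(m)⁻¹]_{ik}·G_{kj}(F) (Minkowski sums of scaled intervals). Then w(I_{ij}(F)) ≤ 1/(32n) and {∂g_i/∂x_j(x) : x ∈ F} ⊆ I_{ij}(F) for all i, j and all faces F; consequently, with c_i^s the center of the face (2B)_i^s, every element of g_i(c_i^+)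 + Σ_{j≠i} I_{ij}((2B)_i^+)·[−w, w] is ≥ w/8 > 0 and every element of g_i(c_i^-) + Σ_{j≠i} I_{ij}((2B)_i^-)·[−w, w] is ≤ −w/8 < 0, i.e., the interval MK test succeeds on B. -/

import Mathlib

/-- The partial derivative `∂f_i/∂x_j` at `x`. -/
noncomputable def pd (n : ℕ) (f : (Fin n → ℝ) → (Fin n → ℝ)) (i j : Fin n)
    (x : Fin n → ℝ) : ℝ :=
  fderiv ℝ (fun y => f y i) x (Pi.single j 1)

/-- The Jacobian matrix of `f` at `x`. -/
noncomputable def Jmat (n : ℕ) (f : (Fin n → ℝ) → (Fin n → ℝ))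
    (x : Fin n → ℝ) : Matrix (Fin n) (Fin n) ℝ :=
  fun i j => pd n f i j x

/-- The matrix `K(C)` with entries `K(C)_{ij} = Σ_k sup_{x∈C} |∂²f_i/(∂x_j∂x_k)(x)|`. -/
noncomputable def Kmat (n : ℕ) (f : (Fin n → ℝ) → (Fin n → ℝ))
    (C : Set (Fin n → ℝ)) : Matrix (Fin n) (Fin n) ℝ :=
  fun i j => ∑ k, sSup ((fun x => |fderiv ℝ (pd n f i j) x (Pi.single k 1)|) '' C)

/-- The maximum-absolute-row-sum norm of a matrix. -/
noncomputable def rowSumNorm (n : ℕ) (A : Matrix (Fin n) (Fin n) ℝ) : ℝ :=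
  ⨆ i, ∑ j, |A i j|

/-- The Euclidean distance on `Fin n → ℝ`. -/
noncomputable def eudist (n : ℕ) (x y : Fin n → ℝ) : ℝ :=
  Real.sqrt (∑ i, (x i - y i) ^ 2)

/-- The box of width `w` centered at `c`. -/
def box (n : ℕ) (c : Fin n → ℝ) (w : ℝ) : Set (Fin n → ℝ) :=
  Set.Icc (fun i => c i - w / 2) (fun i => c i + w / 2)

/-- The `i`-th face of the box of width `w` centered at `c`, with sign `s`
(`true` for the upper face `B_i^+`, `false` for the lower face `B_i^-`). -/
def boxFace (n : ℕ) (c : Fin n → ℝ) (w : ℝ) (i : Fin n) (s : Bool) :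
    Set (Fin n → ℝ) :=
  {x ∈ box n c w | x i = if s then c i + w / 2 else c i - w / 2}

open Set

theorem fderiv_apply_eq_sum {n : ℕ} (L : (Fin n → ℝ) →L[ℝ] ℝ) (v : Fin n → ℝ) :
    L v = ∑ k, L (Pi.single k 1) * v k := by
  conv_lhs => rw [pi_eq_sum_univ' v, map_sum]
  refine Finset.sum_congr rfl fun k _ => ?_
  rw [map_smul, smul_eq_mul, mul_comm]

theorem mean_value_partials {n : ℕ} {h : (Fin n → ℝ) → ℝ} (hh : Differentiable ℝ h)
    {s : Set (Fin n → ℝ)} (hs : Convex ℝ s) {x y : Fin n → ℝ} (hx : x ∈ s) (hy : y ∈ s) :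
    ∃ z ∈ s, h y - h x = ∑ k, fderiv ℝ h z (Pi.single k 1) * (y k - x k) := by
  obtain ⟨z, hz, he⟩ := domain_mvt
    (fun z _ => (hh z).hasFDerivAt.hasFDerivWithinAt) hs hx hy
  exact ⟨z, hs.segment_subset hx hy hz, by rw [he, fderiv_apply_eq_sum]; rfl⟩

section Regularity

variable {n : ℕ} {f : (Fin n → ℝ) → (Fin n → ℝ)}

theorem contDiff_pd (hf : ContDiff ℝ 2 f) (i j : Fin n) : ContDiff ℝ 1 (pd n f i j) :=
  ((contDiff_pi.1 hf i).fderiv_right (m := 1) (by norm_num)).clm_apply contDiff_const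

theorem continuous_Jmat (hf : ContDiff ℝ 2 f) : Continuous (Jmat n f) :=
  continuous_pi fun i => continuous_pi fun j => (contDiff_pd hf i j).continuous

theorem continuousOn_Jmat_inv (hf : ContDiff ℝ 2 f) {s : Set (Fin n → ℝ)}
    (hinv : ∀ x ∈ s, IsUnit (Jmat n f x)) : ContinuousOn (fun x => (Jmat n f x)⁻¹) s := by
  simp only [Matrix.inv_def, Ring.inverse_eq_inv']
  refine ((continuous_Jmat hf).matrix_det.continuousOn.inv₀ fun x hx => ?_).smul
    (continuous_Jmat hf).matrix_adjugate.continuousOn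
  exact ((Matrix.isUnit_iff_isUnit_det _).1 (hinv x hx)).ne_zero

end Regularity

theorem row_sum_le_rowSumNorm {n : ℕ} (A : Matrix (Fin n) (Fin n) ℝ) (i : Fin n) :
    ∑ j, |A i j| ≤ rowSumNorm n A :=
  le_ciSup (f := fun i => ∑ j, |A i j|) (Set.finite_range _).bddAbove i

theorem bddAbove_rowSumNorm_image {n : ℕ} {s : Set (Fin n → ℝ)} (hs : IsCompact s)
    {A : (Fin n → ℝ) → Matrix (Fin n) (Fin n) ℝ} (hA : ContinuousOn A s) :
    BddAbove ((fun x => rowSumNorm n (A x)) '' s) := by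
  have hc : ContinuousOn (fun x => ∑ i, ∑ j, |A x i j|) s :=
    continuousOn_finsetSum _ fun i _ => continuousOn_finsetSum _ fun j _ =>
      ((continuous_id.matrix_elem i j).comp_continuousOn hA).abs
  obtain ⟨M, hM⟩ := hs.bddAbove_image hc
  refine ⟨M, ?_⟩
  rintro _ ⟨x, hx, rfl⟩
  refine le_trans (Real.iSup_le (fun i => ?_) ?_) (hM ⟨x, hx, rfl⟩)
  · exact Finset.single_le_sum (f := fun i => ∑ j, |A x i j|)
      (fun _ _ => Finset.sum_nonneg fun _ _ => abs_nonneg _) (Finset.mem_univ i)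
  · exact Finset.sum_nonneg fun _ _ => Finset.sum_nonneg fun _ _ => abs_nonneg _

theorem isCompact_eudist_ball (n : ℕ) (a : Fin n → ℝ) (R : ℝ) :
    IsCompact {x | eudist n a x ≤ R} := by
  refine isCompact_Icc.of_isClosed_subset
    (s := Icc (fun i => a i - R) (fun i => a i + R)) ?_ fun x hx => ?_
  · unfold eudist
    exact isClosed_le (by fun_prop) continuous_const
  · have key : ∀ i, |a i - x i| ≤ R := fun i =>
      (Real.abs_le_sqrt (Finset.single_le_sum (f := fun i => (a i - x i) ^ 2)
        (fun _ _ => sq_nonneg _) (Finset.mem_univ i))).trans hx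
    exact ⟨fun i => by linarith [(abs_le.1 (key i)).2],
      fun i => by linarith [(abs_le.1 (key i)).1]⟩

theorem eudist_le_of_abs_sub_le {n : ℕ} {x y : Fin n → ℝ} {r : ℝ} (hr : 0 ≤ r)
    (h : ∀ i, |x i - y i| ≤ r) : eudist n x y ≤ √n * r := by
  rw [eudist, ← Real.sqrt_sq hr, ← Real.sqrt_mul (Nat.cast_nonneg n)]
  refine Real.sqrt_le_sqrt ?_
  calc ∑ i, (x i - y i) ^ 2 ≤ ∑ _i : Fin n, r ^ 2 :=
        Finset.sum_le_sum fun i _ => sq_le_sq' (abs_le.1 (h i)).1 (abs_le.1 (h i)).2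
    _ = n * r ^ 2 := by simp

theorem mem_box_iff {n : ℕ} {c x : Fin n → ℝ} {w : ℝ} :
    x ∈ box n c w ↔ ∀ i, |x i - c i| ≤ w / 2 := by
  simp only [box, mem_Icc, Pi.le_def, abs_le, ← forall_and]
  exact forall_congr' fun i => ⟨fun h => ⟨by linarith, by linarith⟩,
    fun h => ⟨by linarith, by linarith⟩⟩

theorem abs_sub_le_of_mem_double_box {n : ℕ} {c a x : Fin n → ℝ} {w : ℝ}
    (ha : a ∈ box n c w) (hx : x ∈ box n c (2 * w)) (i : Fin n) : |x i - a i| ≤ 3 * w / 2 := by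
  have h₁ := abs_le.1 (mem_box_iff.1 ha i)
  have h₂ := abs_le.1 (mem_box_iff.1 hx i)
  exact abs_le.2 ⟨by linarith, by linarith⟩

theorem box_subset_double_box {n : ℕ} {c : Fin n → ℝ} {w : ℝ} (hw : 0 ≤ w) :
    box n c w ⊆ box n c (2 * w) := fun _ hx =>
  mem_box_iff.2 fun i => (mem_box_iff.1 hx i).trans (by linarith)

theorem abs_pd_sub_le {n : ℕ} {f : (Fin n → ℝ) → (Fin n → ℝ)} (hf : ContDiff ℝ 2 f)
    {s C : Set (Fin n → ℝ)} (hs : Convex ℝ s) (hC : IsCompact C) (hsC : s ⊆ C)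
    {x y : Fin n → ℝ} (hx : x ∈ s) (hy : y ∈ s) {r : ℝ} (hr : ∀ k, |y k - x k| ≤ r)
    (i j : Fin n) : |pd n f i j y - pd n f i j x| ≤ Kmat n f C i j * r := by
  have hp := contDiff_pd hf i j
  obtain ⟨z, hz, he⟩ := mean_value_partials (hp.differentiable one_ne_zero) hs hx hy
  rw [he, Kmat, Finset.sum_mul]
  refine (Finset.abs_sum_le_sum_abs _ _).trans (Finset.sum_le_sum fun k _ => ?_)
  have hc : Continuous fun x => |fderiv ℝ (pd n f i j) x (Pi.single k 1)| :=
    ((hp.continuous_fderiv one_ne_zero).clm_apply continuous_const).abs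
  have hle := le_csSup (hC.bddAbove_image hc.continuousOn) ⟨z, hsC hz, rfl⟩
  rw [abs_mul]
  exact mul_le_mul hle (hr k) (abs_nonneg _) ((abs_nonneg _).trans hle)

theorem pd_mulVec {n : ℕ} {f g : (Fin n → ℝ) → (Fin n → ℝ)} (hf : Differentiable ℝ f)
    {A : Matrix (Fin n) (Fin n) ℝ} (hg : ∀ x, g x = A.mulVec (f x)) (i j : Fin n)
    (x : Fin n → ℝ) : pd n g i j x = ∑ k, A i k * pd n f k j x := by
  have hd : ∀ k, DifferentiableAt ℝ (fun y => f y k) x :=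
    fun k => differentiableAt_pi.1 (hf x) k
  have hgi : (fun y => g y i) = fun y => ∑ k, A i k * f y k := by
    ext y; rw [hg]; rfl
  simp only [pd]
  rw [hgi, fderiv_fun_sum fun k _ => (hd k).const_mul _, sum_apply]
  refine Finset.sum_congr rfl fun k _ => ?_
  rw [fderiv_const_mul (hd k)]
  rfl

theorem sum_abs_pd_sub_one_le {n : ℕ} {f g : (Fin n → ℝ) → (Fin n → ℝ)} (hf : ContDiff ℝ 2 f)
    {s C : Set (Fin n → ℝ)} (hs : Convex ℝ s) (hC : IsCompact C) (hsC : s ⊆ C)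
    {m y : Fin n → ℝ} (hm : m ∈ s) (hy : y ∈ s) (hinv : IsUnit (Jmat n f m))
    (hg : ∀ x, g x = (Jmat n f m)⁻¹.mulVec (f x)) {r : ℝ} (hr0 : 0 ≤ r)
    (hr : ∀ k, |y k - m k| ≤ r) (i : Fin n) :
    ∑ j, |pd n g i j y - (1 : Matrix (Fin n) (Fin n) ℝ) i j| ≤
      rowSumNorm n (((Jmat n f m)⁻¹.map fun a => |a|) * Kmat n f C) * r := by
  refine le_trans ?_ (mul_le_mul_of_nonneg_right (row_sum_le_rowSumNorm _ i) hr0)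
  rw [Finset.sum_mul]
  refine Finset.sum_le_sum fun j _ => ?_
  rw [pd_mulVec (hf.differentiable two_ne_zero) hg,
    ← Matrix.nonsing_inv_mul _ ((Matrix.isUnit_iff_isUnit_det _).1 hinv), Matrix.mul_apply,
    ← Finset.sum_sub_distrib]
  refine le_trans ?_ (mul_le_mul_of_nonneg_right (le_abs_self _) hr0)
  rw [Matrix.mul_apply, Finset.sum_mul]
  refine (Finset.abs_sum_le_sum_abs _ _).trans (Finset.sum_le_sum fun k _ => ?_)
  rw [← mul_sub, abs_mul, Matrix.map_apply, mul_assoc]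
  exact mul_le_mul_of_nonneg_left (abs_pd_sub_le hf hs hC hsC hm hy hr k j) (abs_nonneg _)

theorem abs_sub_sub_le_of_pd {n : ℕ} {g : (Fin n → ℝ) → (Fin n → ℝ)} (hg : Differentiable ℝ g)
    {s : Set (Fin n → ℝ)} (hs : Convex ℝ s) {x y : Fin n → ℝ} (hx : x ∈ s) (hy : y ∈ s)
    {r ε : ℝ} (hr : ∀ k, |y k - x k| ≤ r) (hr0 : 0 ≤ r) (i : Fin n)
    (hε : ∀ z ∈ s, ∑ j, |pd n g i j z - (1 : Matrix (Fin n) (Fin n) ℝ) i j| ≤ ε) :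
    |g y i - g x i - (y i - x i)| ≤ ε * r := by
  obtain ⟨z, hz, he⟩ := mean_value_partials (h := fun y => g y i)
    (differentiable_pi.1 hg i) hs hx hy
  have h1 : y i - x i = ∑ j, (1 : Matrix (Fin n) (Fin n) ℝ) i j * (y j - x j) := by
    simp [Matrix.one_apply]
  rw [he, h1, ← Finset.sum_sub_distrib]
  refine le_trans ?_ (mul_le_mul_of_nonneg_right (hε z hz) hr0)
  rw [Finset.sum_mul]
  refine (Finset.abs_sum_le_sum_abs _ _).trans (Finset.sum_le_sum fun k _ => ?_)
  rw [← sub_mul, abs_mul]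
  exact mul_le_mul_of_nonneg_left (hr k) (abs_nonneg _)

theorem abs_sum_erase_mul_le {n : ℕ} (i : Fin n) {p t s : Fin n → ℝ} {w δ ε : ℝ}
    (hw : 0 ≤ w) (hδ : 0 ≤ δ)
    (hp : ∑ j, |p j - (1 : Matrix (Fin n) (Fin n) ℝ) i j| ≤ ε)
    (ht : ∀ j, j ≠ i → |t j - p j| ≤ δ) (hs : ∀ j, |s j| ≤ w) :
    |∑ j ∈ Finset.univ.erase i, t j * s j| ≤ (ε + n * δ) * w := by
  calc |∑ j ∈ Finset.univ.erase i, t j * s j|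
      ≤ ∑ j ∈ Finset.univ.erase i,
          (|p j - (1 : Matrix (Fin n) (Fin n) ℝ) i j| + δ) * w := by
        refine (Finset.abs_sum_le_sum_abs _ _).trans (Finset.sum_le_sum fun j hj => ?_)
        have hji := Finset.ne_of_mem_erase hj
        rw [abs_mul, Matrix.one_apply_ne hji.symm, sub_zero]
        refine mul_le_mul ?_ (hs j) (abs_nonneg _) (by positivity)
        have := abs_add_le (p j) (t j - p j)
        rw [add_sub_cancel] at this
        linarith [ht j hji]
    _ ≤ ∑ j, (|p j - (1 : Matrix (Fin n) (Fin n) ℝ) i j| + δ) * w :=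
        Finset.sum_le_sum_of_subset_of_nonneg (Finset.erase_subset _ _)
          fun _ _ _ => by positivity
    _ ≤ (ε + n * δ) * w := by
        rw [← Finset.sum_mul, Finset.sum_add_distrib]
        refine mul_le_mul_of_nonneg_right ?_ hw
        simpa using hp

/-- **Sure success of the interval MK test (part b).** With the smallness
conditions of the abstract MK test and `w ≤ 1/(64n²L·sup‖J⁻¹‖)`, if on each
face `F = (2B)_i^s` the partials `∂f_j/∂x_k` are enclosed in intervals
`G_{jk}(F)` of width at most `2Lw`, then the preconditioned intervals
`I_{ij}(F) = Σ_k [J(m)⁻¹]_{ik}·G_{kj}(F)` have width at most `1/(32n)` and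
enclose `∂g_i/∂x_j` on `F`; consequently every element of
`g_i(c_i^+) + Σ_{j≠i} I_{ij}((2B)_i^+)·[−w, w]` is `≥ w/8 > 0` and every
element of `g_i(c_i^-) + Σ_{j≠i} I_{ij}((2B)_i^-)·[−w, w]` is `≤ −w/8 < 0`. -/
theorem mk_interval_sure_success_b (n : ℕ) (f : (Fin n → ℝ) → (Fin n → ℝ))
    (hf : ContDiff ℝ 2 f) (α : Fin n → ℝ) (hroot : f α = 0)
    (c : Fin n → ℝ) (w : ℝ) (hw : 0 < w) (hα : α ∈ box n c w)
    (lam : ℝ) (hlam : w ≤ lam)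
    (Δ : Set (Fin n → ℝ)) (hΔ : Δ = {x | eudist n α x ≤ 2 * Real.sqrt n * lam})
    (hinv : ∀ x ∈ Δ, IsUnit (Jmat n f x))
    (hsmall : 27 * n * lam *
      sSup ((fun x => rowSumNorm n (((Jmat n f x)⁻¹.map fun a => |a|) * Kmat n f Δ))
        '' Δ) ≤ 1)
    (m : Fin n → ℝ) (hm : m ∈ box n c w)
    (g : (Fin n → ℝ) → (Fin n → ℝ)) (hg : ∀ x, g x = (Jmat n f m)⁻¹.mulVec (f x))
    (L : ℝ) (hL : 0 < L)
    (hwL : w ≤ 1 / (64 * n ^ 2 * L *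
      sSup ((fun x => rowSumNorm n ((Jmat n f x)⁻¹)) '' Δ)))
    -- the intervals `G_{jk}((2B)_i^s) = [GA i s j k, GB i s j k]`
    (GA GB : Fin n → Bool → Fin n → Fin n → ℝ)
    (hGle : ∀ i s j k, GA i s j k ≤ GB i s j k)
    (hGmem : ∀ (i : Fin n) (s : Bool) (j k : Fin n),
      ∀ x ∈ boxFace n c (2 * w) i s,
        pd n f j k x ∈ Set.Icc (GA i s j k) (GB i s j k))
    (hGw : ∀ i s j k, GB i s j k - GA i s j k ≤ 2 * L * w)
    -- the preconditioned intervals `I_{ij}((2B)_i^s) = Σ_k [J(m)⁻¹]_{ik}·G_{kj}((2B)_i^s)`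
    (ISet : Fin n → Bool → Fin n → Set ℝ)
    (hISet : ∀ (i : Fin n) (s : Bool) (j : Fin n),
      ISet i s j = {v | ∃ t : Fin n → ℝ,
        (∀ k, t k ∈ Set.Icc (GA i s k j) (GB i s k j)) ∧
        v = ∑ k, (Jmat n f m)⁻¹ i k * t k}) :
    (∀ (i : Fin n) (s : Bool) (j : Fin n),
      ∀ u ∈ ISet i s j, ∀ v ∈ ISet i s j, |u - v| ≤ 1 / (32 * n)) ∧
    (∀ (i : Fin n) (s : Bool) (j : Fin n),
      ∀ x ∈ boxFace n c (2 * w) i s, pd n g i j x ∈ ISet i s j) ∧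
    (∀ i : Fin n,
      (∀ t s' : Fin n → ℝ,
        (∀ j, j ≠ i → t j ∈ ISet i true j) →
        (∀ j, s' j ∈ Set.Icc (-w) w) →
        w / 8 ≤ g (Function.update c i (c i + w)) i +
          ∑ j ∈ Finset.univ.erase i, t j * s' j) ∧
      (∀ t s' : Fin n → ℝ,
        (∀ j, j ≠ i → t j ∈ ISet i false j) →
        (∀ j, s' j ∈ Set.Icc (-w) w) →
        g (Function.update c i (c i - w)) i +
          ∑ j ∈ Finset.univ.erase i, t j * s' j ≤ -(w / 8))) := by
  have hΔc : IsCompact Δ := hΔ ▸ isCompact_eudist_ball n α _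
  have hw2 : 0 ≤ 3 * w / 2 := by linarith
  have hconv : Convex ℝ (box n c (2 * w)) := convex_Icc _ _
  have hsub : box n c (2 * w) ⊆ Δ := by
    intro x hx
    rw [hΔ, mem_ofPred_eq]
    refine (eudist_le_of_abs_sub_le hw2 fun i => ?_).trans ?_
    · rw [abs_sub_comm]
      exact abs_sub_le_of_mem_double_box hα hx i
    · rw [mul_comm 2 √(n : ℝ), mul_assoc]
      exact mul_le_mul_of_nonneg_left (by linarith) (Real.sqrt_nonneg _)
  have hm2 := box_subset_double_box hw.le hm
  have hα2 := box_subset_double_box hw.le hα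
  have hmΔ := hsub hm2
  have hinvc := continuousOn_Jmat_inv hf hinv
  have hfd : Differentiable ℝ f := hf.differentiable two_ne_zero
  have hwidth : ∀ (i : Fin n) (s : Bool) (j : Fin n),
      ∀ u ∈ ISet i s j, ∀ v ∈ ISet i s j, |u - v| ≤ 1 / (32 * n) := by
    intro i s j u hu v hv
    have hn : (1 : ℝ) ≤ n := by exact_mod_cast i.pos
    rw [hISet] at hu hv
    obtain ⟨t, ht, rfl⟩ := hu
    obtain ⟨t', ht', rfl⟩ := hv
    set S := sSup ((fun x => rowSumNorm n ((Jmat n f x)⁻¹)) '' Δ)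
    have hS : rowSumNorm n ((Jmat n f m)⁻¹) ≤ S :=
      le_csSup (bddAbove_rowSumNorm_image hΔc hinvc) ⟨m, hmΔ, rfl⟩
    have hpos : 0 < 64 * n ^ 2 * L * S := one_div_pos.1 (hw.trans_le hwL)
    rw [le_div_iff₀ hpos] at hwL
    have hS0 : 0 < S := pos_of_mul_pos_right hpos (by positivity)
    calc |∑ k, (Jmat n f m)⁻¹ i k * t k - ∑ k, (Jmat n f m)⁻¹ i k * t' k|
        ≤ ∑ k, |(Jmat n f m)⁻¹ i k| * (2 * L * w) := by
          rw [← Finset.sum_sub_distrib]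
          refine (Finset.abs_sum_le_sum_abs _ _).trans (Finset.sum_le_sum fun k _ => ?_)
          rw [← mul_sub, abs_mul]
          refine mul_le_mul_of_nonneg_left ?_ (abs_nonneg _)
          have h₁ := ht k
          have h₂ := ht' k
          have h₃ := hGw i s k j
          exact abs_le.2 ⟨by linarith [h₁.1, h₂.2], by linarith [h₁.2, h₂.1]⟩
      _ ≤ S * (2 * L * w) := by
          rw [← Finset.sum_mul]
          exact mul_le_mul_of_nonneg_right ((row_sum_le_rowSumNorm _ i).trans hS)
            (by positivity)
      _ ≤ 1 / (32 * n) := by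
          rw [le_div_iff₀ (by positivity)]
          have : 0 ≤ L * S * w * n * (n - 1) :=
            mul_nonneg (by positivity) (by linarith)
          nlinarith
  have hencl : ∀ (i : Fin n) (s : Bool) (j : Fin n),
      ∀ x ∈ boxFace n c (2 * w) i s, pd n g i j x ∈ ISet i s j := by
    intro i s j x hx
    rw [hISet]
    exact ⟨fun k => pd n f k j x, fun k => hGmem i s k j x hx, pd_mulVec hfd hg i j x⟩
  have hgd : Differentiable ℝ g := by
    rw [show g = fun x => (Jmat n f m)⁻¹.mulVecLin (f x) from funext hg]
    exact (LinearMap.toContinuousLinearMap (Jmat n f m)⁻¹.mulVecLin).differentiable.comp hfd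
  have hgα : g α = 0 := by rw [hg, hroot, Matrix.mulVec_zero]
  have hrow : ∀ i : Fin n, ∀ y ∈ box n c (2 * w),
      ∑ j, |pd n g i j y - (1 : Matrix (Fin n) (Fin n) ℝ) i j| ≤ 1 / 18 := by
    intro i y hy
    have hn : (1 : ℝ) ≤ n := by exact_mod_cast i.pos
    refine (sum_abs_pd_sub_one_le hf hconv hΔc hsub hm2 hy (hinv m hmΔ) hg hw2
      (abs_sub_le_of_mem_double_box hm hy) i).trans ?_
    set κ := rowSumNorm n (((Jmat n f m)⁻¹.map fun a => |a|) * Kmat n f Δ)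
    have hcont : ContinuousOn
        (fun x => ((Jmat n f x)⁻¹.map fun a => |a|) * Kmat n f Δ) Δ :=
      ((continuous_id.matrix_map continuous_abs).matrix_mul
        continuous_const).comp_continuousOn hinvc
    have hκ := le_csSup (bddAbove_rowSumNorm_image hΔc hcont) ⟨m, hmΔ, rfl⟩
    have hκ0 : 0 ≤ κ := Real.iSup_nonneg fun _ => Finset.sum_nonneg fun _ _ => abs_nonneg _
    have h₁ : 27 * n * lam * κ ≤ 1 :=
      (mul_le_mul_of_nonneg_left hκ (by have := hw.trans_le hlam; positivity)).trans hsmall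
    have h₂ : w * κ ≤ lam * κ := mul_le_mul_of_nonneg_right hlam hκ0
    have h₃ : 0 ≤ (n - 1) * (lam * κ) :=
      mul_nonneg (by linarith) ((mul_nonneg hw.le hκ0).trans h₂)
    nlinarith
  have hface : ∀ (i : Fin n) (s : Bool) (x : Fin n → ℝ), x ∈ boxFace n c (2 * w) i s →
      ∀ t s' : Fin n → ℝ, (∀ j, j ≠ i → t j ∈ ISet i s j) →
        (∀ j, s' j ∈ Set.Icc (-w) w) →
        |g x i + ∑ j ∈ Finset.univ.erase i, t j * s' j - (x i - α i)| ≤ w / 4 := by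
    intro i s x hx t s' ht hs'
    have hn : (n : ℝ) ≠ 0 := by exact_mod_cast i.pos.ne'
    have h₁ := abs_sub_sub_le_of_pd hgd hconv hα2 hx.1
      (abs_sub_le_of_mem_double_box hα hx.1) hw2 i (hrow i)
    have h₂ := abs_sum_erase_mul_le i (δ := 1 / (32 * n)) (t := t) (s := s') hw.le (by positivity)
      (hrow i x hx.1) (fun j hj => hwidth i s j _ (ht j hj) _ (hencl i s j x hx))
      (fun j => abs_le.2 (hs' j))
    rw [show (n : ℝ) * (1 / (32 * n)) = 1 / 32 by field_simp] at h₂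
    rw [hgα, Pi.zero_apply, sub_zero, abs_le] at h₁
    rw [abs_le] at h₂ ⊢
    exact ⟨by linarith [h₁.1, h₂.1], by linarith [h₁.2, h₂.2]⟩
  have hcenter : ∀ (i : Fin n) (v : ℝ), |v - c i| ≤ w →
      Function.update c i v ∈ box n c (2 * w) := by
    refine fun i v hv => mem_box_iff.2 fun j => ?_
    rcases eq_or_ne j i with rfl | hj
    · rw [Function.update_self]
      linarith
    · rw [Function.update_of_ne hj, sub_self, abs_zero]
      linarith
  refine ⟨hwidth, hencl, fun i => ⟨fun t s' ht hs' => ?_, fun t s' ht hs' => ?_⟩⟩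
  · have h := hface i true _ ⟨hcenter i (c i + w) (by simp [abs_of_pos hw]), by simp⟩ t s' ht hs'
    rw [Function.update_self] at h
    linarith [(abs_le.1 h).1, (abs_le.1 (mem_box_iff.1 hα i)).2]
  · have h := hface i false _ ⟨hcenter i (c i - w) (by simp [abs_of_pos hw]), by simp⟩ t s' ht hs'
    rw [Function.update_self] at h
    linarith [(abs_le.1 h).2, (abs_le.1 (mem_box_iff.1 hα i)).1]
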